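/- arXiv:0809.0127 — 2 statements merged into one kernel-verified Lean document; each statement's English description precedes it below -/
import Mathlib

section
/- For every integer m ≥ 2 and every integer i with 1 ≤ i ≤ m−1, one has (d_{i-1}(m)/C(m, i−1)) · (d_{i+1}(m)/C(m, i+1)) > (d_i(m)/C(m, i))^2; that is, the Boros–Moll sequence {d_i(m)}_{0≤i≤m} is strictly reverse ultra log-concave. -/
/-- The Boros-Moll coefficient `d_i(m)`, as a real number:
`d_i(m) = 4^(-m) * sum_{k=0}^m 2^k * C(2m-2k, m-k) * C(m+k, m) * C(k, i)`. -/
noncomputable def d (m i : ℕ) : ℝ :=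
  (∑ k ∈ Finset.range (m + 1),
      (2 : ℝ) ^ k * (Nat.choose (2 * m - 2 * k) (m - k) : ℝ) *
        (Nat.choose (m + k) m : ℝ) * (Nat.choose k i : ℝ)) / 4 ^ m

/-- The binomial transform of `c` of order `n`, based at `p`. -/
def binomialTransform (c : ℕ → ℝ) (n p : ℕ) : ℝ :=
  ∑ j ∈ Finset.range (n + 1), (n.choose j : ℝ) * c (p + j)

theorem binomialTransform_zero (c : ℕ → ℝ) (p : ℕ) : binomialTransform c 0 p = c p := by
  simp [binomialTransform]

theorem binomialTransform_succ (c : ℕ → ℝ) (n p : ℕ) :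
    binomialTransform c (n + 1) p = binomialTransform c n p + binomialTransform c n (p + 1) := by
  have h := Finset.sum_choose_succ_mul (R := ℝ) (fun i _ => c (p + i)) n
  simp only [binomialTransform]
  rw [h, add_comm]
  simp only [add_comm, add_left_comm]

theorem binomialTransform_pos {c : ℕ → ℝ} {n p : ℕ} (hc : ∀ k ≤ p + n, 0 < c k) :
    0 < binomialTransform c n p := by
  refine Finset.sum_pos (fun j hj => ?_) (by simp)
  have hj' : j ≤ n := Nat.lt_succ_iff.mp (Finset.mem_range.mp hj)
  exact mul_pos (by exact_mod_cast Nat.choose_pos hj') (hc _ (by omega))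

/-- Strict log-convexity is preserved by addition. -/
theorem add_sq_lt_add_mul_add {x y z u v w : ℝ} (hx : 0 < x) (hz : 0 < z) (hu : 0 < u)
    (hw : 0 < w) (h₁ : y ^ 2 < x * z) (h₂ : v ^ 2 < u * w) :
    (y + v) ^ 2 < (x + u) * (z + w) := by
  have h : (y * v) ^ 2 ≤ (x * z) * (u * w) := by
    rw [mul_pow]
    exact mul_le_mul h₁.le h₂.le (sq_nonneg v) (by positivity)
  have h' : 2 * (y * v) ≤ x * w + u * z := by
    refine le_of_sq_le_sq ?_ (by positivity)
    nlinarith [sq_nonneg (x * w - u * z)]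
  nlinarith

theorem binomialTransform_sq_lt {c : ℕ → ℝ} {m : ℕ} (hpos : ∀ k ≤ m, 0 < c k)
    (hc : ∀ k, k + 2 ≤ m → c (k + 1) ^ 2 < c k * c (k + 2)) (n p : ℕ) (h : p + n + 2 ≤ m) :
    binomialTransform c n (p + 1) ^ 2 <
      binomialTransform c n p * binomialTransform c n (p + 2) := by
  induction n generalizing p with
  | zero => simpa only [binomialTransform_zero] using hc p h
  | succ n ih =>
    have hb : ∀ q ≤ p + 3, 0 < binomialTransform c n q := fun q hq =>
      binomialTransform_pos fun k hk => hpos k (by omega)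
    simp only [binomialTransform_succ]
    exact add_sq_lt_add_mul_add (hb _ (by omega)) (hb _ (by omega)) (hb _ (by omega))
      (hb _ (by omega)) (ih p (by omega)) (ih (p + 1) (by omega))

/-- The coefficients of the Boros-Moll polynomial in powers of `a + 1`, divided by the
corresponding binomial coefficients. -/
noncomputable def borosMollWeight (m k : ℕ) : ℝ :=
  (2 : ℝ) ^ k * (Nat.choose (2 * m - 2 * k) (m - k) : ℝ) * (Nat.choose (m + k) m : ℝ) /
    (Nat.choose m k : ℝ) / 4 ^ m

theorem borosMollWeight_pos {m k : ℕ} (hk : k ≤ m) : 0 < borosMollWeight m k := by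
  have h₁ : 0 < Nat.choose (2 * m - 2 * k) (m - k) := Nat.choose_pos (by omega)
  have h₂ : 0 < Nat.choose (m + k) m := Nat.choose_pos (by omega)
  have h₃ : 0 < Nat.choose m k := Nat.choose_pos hk
  unfold borosMollWeight
  positivity

theorem borosMollWeight_succ (k r : ℕ) :
    (2 * r + 1) * borosMollWeight (k + r + 1) (k + 1) =
      (2 * k + r + 2) * borosMollWeight (k + r + 1) k := by
  have hD : (Nat.choose (k + r + 1) (k + 1) : ℝ) =
      Nat.choose (k + r + 1) k * (r + 1) / (k + 1) := by
    rw [eq_div_iff (by positivity)]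
    have := Nat.choose_succ_right_eq (k + r + 1) k
    rw [show k + r + 1 - k = r + 1 by omega] at this
    exact_mod_cast this
  have hM : (Nat.choose (k + r + 1 + (k + 1)) (k + r + 1) : ℝ) =
      (2 * k + r + 2) * Nat.choose (k + r + 1 + k) (k + r + 1) / (k + 1) := by
    rw [eq_div_iff (by positivity)]
    have := Nat.add_one_mul_choose_eq (k + r + 1 + k) k
    rw [Nat.choose_symm_of_eq_add (show k + r + 1 + k = k + (k + r + 1) by ring),
      Nat.choose_symm_of_eq_add
        (show k + r + 1 + k + 1 = (k + 1) + (k + r + 1) by ring)]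
      at this
    have h' := congrArg (Nat.cast (R := ℝ)) this
    push_cast at h'
    rw [show k + r + 1 + (k + 1) = k + r + 1 + k + 1 by omega]
    linarith
  have hC : (Nat.choose (2 * (k + r + 1) - 2 * k) (k + r + 1 - k) : ℝ) =
      2 * (2 * r + 1) *
        Nat.choose (2 * (k + r + 1) - 2 * (k + 1)) (k + r + 1 - (k + 1)) / (r + 1) := by
    rw [eq_div_iff (by positivity)]
    have := Nat.succ_mul_centralBinom_succ r
    simp only [Nat.centralBinom] at this
    rw [show 2 * (k + r + 1) - 2 * k = 2 * (r + 1) by omega,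
      show k + r + 1 - k = r + 1 by omega,
      show 2 * (k + r + 1) - 2 * (k + 1) = 2 * r by omega,
      show k + r + 1 - (k + 1) = r by omega, mul_comm]
    exact_mod_cast this
  have hD₀ : (Nat.choose (k + r + 1) k : ℝ) ≠ 0 := by
    exact_mod_cast (Nat.choose_pos (by omega)).ne'
  unfold borosMollWeight
  rw [hD, hM, hC]
  field_simp
  ring

theorem borosMollWeight_sq_lt {m k : ℕ} (h : k + 2 ≤ m) :
    borosMollWeight m (k + 1) ^ 2 < borosMollWeight m k * borosMollWeight m (k + 2) := by
  obtain ⟨r, rfl⟩ : ∃ r, m = k + r + 2 := ⟨m - k - 2, by omega⟩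
  have h₀ := borosMollWeight_succ k (r + 1)
  have h₁ := borosMollWeight_succ (k + 1) r
  rw [show k + 1 + r + 1 = k + r + 2 by ring] at h₁
  rw [show k + (r + 1) + 1 = k + r + 2 by ring] at h₀
  have hx : 0 < borosMollWeight (k + r + 2) (k + 1) := borosMollWeight_pos (by omega)
  push_cast at h₀ h₁
  rw [show k + 1 + 1 = k + 2 by ring] at h₁
  have e₀ : borosMollWeight (k + r + 2) k =
      (2 * r + 3) / (2 * k + r + 3) * borosMollWeight (k + r + 2) (k + 1) := by
    field_simp
    linarith
  have e₁ : borosMollWeight (k + r + 2) (k + 2) =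
      (2 * k + r + 4) / (2 * r + 1) * borosMollWeight (k + r + 2) (k + 1) := by
    field_simp
    linarith
  have hr : (1 : ℝ) < (2 * r + 3) / (2 * k + r + 3) * ((2 * k + r + 4) / (2 * r + 1)) := by
    rw [div_mul_div_comm, one_lt_div (by positivity)]
    have hk0 : (0 : ℝ) ≤ k := k.cast_nonneg
    have hr0 : (0 : ℝ) ≤ r := r.cast_nonneg
    nlinarith
  rw [e₀, e₁]
  nlinarith [pow_pos hx 2]

theorem d_div_choose {m i : ℕ} (hi : i ≤ m) :
    d m i / (Nat.choose m i : ℝ) = binomialTransform (borosMollWeight m) (m - i) i := by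
  obtain ⟨n, rfl⟩ := Nat.exists_eq_add_of_le hi
  have hC : (Nat.choose (i + n) i : ℝ) ≠ 0 := by exact_mod_cast (Nat.choose_pos hi).ne'
  rw [div_eq_iff hC, d, Finset.sum_div, binomialTransform, Finset.sum_mul, add_assoc,
    Finset.sum_range_add, Finset.sum_eq_zero, zero_add, Nat.add_sub_cancel_left]
  · refine Finset.sum_congr rfl fun j hj => ?_
    have hj' : j ≤ n := Nat.lt_succ_iff.mp (Finset.mem_range.mp hj)
    have h := Nat.choose_mul (n := i + n) (k := i + j) (s := i) (by omega)
    rw [Nat.add_sub_cancel_left, Nat.add_sub_cancel_left] at h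
    have h' : (Nat.choose (i + n) (i + j) : ℝ) * Nat.choose (i + j) i =
        Nat.choose (i + n) i * Nat.choose n j := by exact_mod_cast h
    have hD : (Nat.choose (i + n) (i + j) : ℝ) ≠ 0 := by
      exact_mod_cast (Nat.choose_pos (by omega)).ne'
    unfold borosMollWeight
    field_simp
    linear_combination (Nat.choose (2 * (i + n) - 2 * (i + j)) (i + n - (i + j)) : ℝ) *
      Nat.choose (i + n + (i + j)) (i + n) * h'
  · intro k hk
    simp [Nat.choose_eq_zero_of_lt (Finset.mem_range.mp hk)]

theorem boros_moll_reverse_ultra_log_concave (m i : ℕ) (hm : 2 ≤ m) (hi : 1 ≤ i)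
    (hi' : i ≤ m - 1) :
    (d m (i - 1) / (Nat.choose m (i - 1) : ℝ)) * (d m (i + 1) / (Nat.choose m (i + 1) : ℝ)) >
      (d m i / (Nat.choose m i : ℝ)) ^ 2 := by
  obtain ⟨p, rfl⟩ : ∃ p, i = p + 1 := ⟨i - 1, by omega⟩
  obtain ⟨n, rfl⟩ : ∃ n, m = p + n + 2 := ⟨m - p - 2, by omega⟩
  have h := binomialTransform_sq_lt (c := borosMollWeight (p + n + 2)) (fun k hk => borosMollWeight_pos hk)
    (fun k hk => borosMollWeight_sq_lt hk) n p le_rfl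
  rw [d_div_choose (by omega), d_div_choose (by omega), d_div_choose (by omega),
    show p + n + 2 - (p + 1 - 1) = n + 1 + 1 by omega,
    show p + n + 2 - (p + 1 + 1) = n by omega,
    show p + n + 2 - (p + 1) = n + 1 by omega]
  simp only [binomialTransform_succ, Nat.add_sub_cancel]
  rw [show p + 1 + 1 = p + 2 by ring]
  nlinarith
end

section
/- For every integer m ≥ 2 and every integer i with 1 ≤ i ≤ m−1, one has d_i(m+1)/d_i(m) < T(m,i), where T(m,i) = (4m^2 + 7m + 3 + i·√(4m + 4i^2 + 1) − 2i^2) / (2(m−i+1)(m+1)). -/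
/-- `T(m,i) = (4m^2 + 7m + 3 + i*sqrt(4m + 4i^2 + 1) - 2i^2) / (2(m-i+1)(m+1))`. -/
noncomputable def T (m i : ℕ) : ℝ :=
  (4 * (m : ℝ) ^ 2 + 7 * m + 3 + i * Real.sqrt (4 * m + 4 * i ^ 2 + 1) - 2 * i ^ 2) /
    (2 * ((m : ℝ) - i + 1) * ((m : ℝ) + 1))

/-- The summand of `d (k + D) i` at index `k`. -/
noncomputable def borosMollTerm (i k D : ℕ) : ℝ :=
  2 ^ k * (Nat.centralBinom D : ℝ) * (Nat.choose (k + D + k) (k + D) : ℝ) *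
    (Nat.choose k i : ℝ) / 4 ^ (k + D)

theorem d_eq_sum_borosMollTerm (m i : ℕ) :
    d m i = ∑ k ∈ Finset.range (m + 1), borosMollTerm i k (m - k) := by
  unfold d
  rw [Finset.sum_div]
  refine Finset.sum_congr rfl fun k hk => ?_
  obtain ⟨D, rfl⟩ := Nat.exists_eq_add_of_le (Nat.lt_succ_iff.mp (Finset.mem_range.mp hk))
  have h₁ : 2 * (k + D) - 2 * k = 2 * D := by omega
  have h₂ : k + D - k = D := by omega
  rw [h₁, h₂, borosMollTerm, Nat.centralBinom]

theorem borosMollTerm_nonneg (i k D : ℕ) : 0 ≤ borosMollTerm i k D := by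
  unfold borosMollTerm; positivity

theorem borosMollTerm_pos {i k : ℕ} (h : i ≤ k) (D : ℕ) : 0 < borosMollTerm i k D := by
  have h₁ := Nat.centralBinom_pos D
  have h₂ : 0 < Nat.choose (k + D + k) (k + D) := Nat.choose_pos (by omega)
  have h₃ := Nat.choose_pos h
  unfold borosMollTerm; positivity

theorem borosMollTerm_eq_zero {i k : ℕ} (h : k < i) (D : ℕ) : borosMollTerm i k D = 0 := by
  simp [borosMollTerm, Nat.choose_eq_zero_of_lt h]

theorem d_pos {m i : ℕ} (h : i ≤ m) : 0 < d m i := by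
  rw [d_eq_sum_borosMollTerm]
  exact Finset.sum_pos' (fun k _ => borosMollTerm_nonneg i k _)
    ⟨m, Finset.mem_range.mpr m.lt_succ_self, borosMollTerm_pos h _⟩

theorem cast_centralBinom_succ (D : ℕ) :
    (Nat.centralBinom (D + 1) : ℝ) = 2 * (2 * D + 1) * Nat.centralBinom D / (D + 1) := by
  rw [eq_div_iff (by positivity)]
  have := Nat.succ_mul_centralBinom_succ D
  rw [mul_comm]
  exact_mod_cast this

theorem borosMollTerm_succ_right (i k D : ℕ) :
    borosMollTerm i k (D + 1) =
      (2 * D + 1) * (2 * k + D + 1) / (2 * (D + 1) * (k + D + 1)) * borosMollTerm i k D := by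
  have h : (Nat.choose (k + (D + 1) + k) (k + (D + 1)) : ℝ) =
      (2 * k + D + 1) * Nat.choose (k + D + k) (k + D) / (k + D + 1) := by
    rw [eq_div_iff (by positivity)]
    have := Nat.add_one_mul_choose_eq (k + D + k) (k + D)
    rw [show k + (D + 1) + k = k + D + k + 1 by ring, show k + (D + 1) = k + D + 1 by ring]
    have h' : ((k + D + k + 1 : ℕ) : ℝ) * (Nat.choose (k + D + k) (k + D) : ℝ) =
      (Nat.choose (k + D + k + 1) (k + D + 1) : ℝ) * ((k + D + 1 : ℕ) : ℝ) := by
      exact_mod_cast this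
    push_cast at h'
    linarith
  unfold borosMollTerm
  rw [h, cast_centralBinom_succ, ← add_assoc k D 1, pow_succ]
  field_simp
  ring

theorem borosMollTerm_succ_left (i k D : ℕ) :
    ((k : ℝ) + 1 - i) * (2 * D + 1) * borosMollTerm i (k + 1) D =
      (D + 1) * (2 * k + D + 2) * borosMollTerm i k (D + 1) := by
  have h : (Nat.choose (k + 1 + D + (k + 1)) (k + 1 + D) : ℝ) =
      (2 * k + D + 2) * Nat.choose (k + (D + 1) + k) (k + (D + 1)) / (k + 1) := by
    rw [eq_div_iff (by positivity)]
    have := Nat.choose_mul_succ_eq (k + (D + 1) + k) (k + (D + 1))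
    rw [show k + (D + 1) + k + 1 - (k + (D + 1)) = k + 1 by omega] at this
    rw [show k + 1 + D + (k + 1) = k + (D + 1) + k + 1 by ring,
      show k + 1 + D = k + (D + 1) by ring]
    have h' : (Nat.choose (k + (D + 1) + k) (k + (D + 1)) : ℝ) * ((k + (D + 1) + k + 1 : ℕ) : ℝ) =
      (Nat.choose (k + (D + 1) + k + 1) (k + (D + 1)) : ℝ) * ((k + 1 : ℕ) : ℝ) := by
      exact_mod_cast this
    push_cast at h'
    linarith
  have hc : ((k : ℝ) + 1 - i) * Nat.choose (k + 1) i = (k + 1) * Nat.choose k i := by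
    rcases le_or_gt i (k + 1) with hik | hik
    · have := Nat.choose_mul_succ_eq k i
      have h' : (Nat.choose k i : ℝ) * ((k + 1 : ℕ) : ℝ) =
        (Nat.choose (k + 1) i : ℝ) * ((k + 1 - i : ℕ) : ℝ) := by exact_mod_cast this
      rw [Nat.cast_sub hik] at h'
      push_cast at h'
      linarith
    · rw [Nat.choose_eq_zero_of_lt hik, Nat.choose_eq_zero_of_lt (by omega : k < i)]
      simp
  unfold borosMollTerm
  rw [h, cast_centralBinom_succ, show k + 1 + D = k + (D + 1) by ring, pow_succ]
  field_simp
  linear_combination (Nat.centralBinom D : ℝ) * (Nat.choose (k + (D + 1) + k) (k + (D + 1)) : ℝ) * hc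

/-- The polynomial in the creative telescoping certificate of the recurrence for `d`. -/
noncomputable def certPoly (m i k : ℝ) : ℝ :=
  4 * (m + 2 - i) * k ^ 2 + (-8 * m ^ 2 - 20 * m - 14 + 4 * i) * k +
    (2 * (2 * m + 3) * (m + 2) - 4 * (m + 2 - i) * (m + 2) ^ 2 -
      (-8 * m ^ 2 - 20 * m - 14 + 4 * i) * (m + 2))

/-- The recurrence operator for `d` applied to three numbers. -/
noncomputable def recOp (m i z₂ z₁ z₀ : ℝ) : ℝ :=
  4 * (m + 2 - i) * (m + 1) * (m + 2) * z₂ -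
    2 * (m + 1) * (8 * m ^ 2 + 24 * m + 19 - 4 * i ^ 2) * z₁ +
    (m + i + 1) * (4 * m + 3) * (4 * m + 5) * z₀

theorem sum_recOp_borosMollTerm {i : ℕ} (hi : 1 ≤ i) (n D : ℕ) :
    (∑ k ∈ Finset.range (n + 1), recOp ((n + D : ℕ) : ℝ) i (borosMollTerm i k (n + D + 2 - k))
      (borosMollTerm i k (n + D + 1 - k)) (borosMollTerm i k (n + D - k))) * (D + 1) =
    certPoly ((n + D : ℕ) : ℝ) i (n + 1) * (2 * n + D + 1) * borosMollTerm i n D := by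
  induction n generalizing D with
  | zero =>
    simp [borosMollTerm_eq_zero (show 0 < i by omega), recOp]
  | succ n ih =>
    rw [Finset.sum_range_succ]
    have ih := ih (D + 1)
    rw [show n + (D + 1) = n + 1 + D by ring] at ih
    rw [show n + 1 + D + 2 - (n + 1) = D + 1 + 1 by omega,
      show n + 1 + D + 1 - (n + 1) = D + 1 by omega, show n + 1 + D - (n + 1) = D by omega]
    set S := ∑ k ∈ Finset.range (n + 1), recOp ((n + 1 + D : ℕ) : ℝ) i
      (borosMollTerm i k (n + 1 + D + 2 - k))
      (borosMollTerm i k (n + 1 + D + 1 - k)) (borosMollTerm i k (n + 1 + D - k))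
    have hl := borosMollTerm_succ_left i n D
    have hS : S * (D + 2) * (D + 1) = certPoly ((n + 1 + D : ℕ) : ℝ) i (n + 1) *
        (((n : ℝ) + 1 - i) * (2 * D + 1) * borosMollTerm i (n + 1) D) := by
      rw [hl]
      push_cast at ih ⊢
      linear_combination ((D : ℝ) + 1) * ih
    rw [borosMollTerm_succ_right i (n + 1) (D + 1), borosMollTerm_succ_right i (n + 1) D]
    refine mul_left_cancel₀ (show (D : ℝ) + 2 ≠ 0 by positivity) ?_
    rw [← sub_eq_zero] at hS ⊢
    rw [← hS]
    unfold recOp certPoly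
    push_cast
    field_simp
    ring

theorem recOp_d {m i : ℕ} (hi : 1 ≤ i) (him : i ≤ m) :
    recOp m i (d (m + 2) i) (d (m + 1) i) (d m i) = 0 := by
  have hs := sum_recOp_borosMollTerm hi m 0
  have hl₁ := borosMollTerm_succ_left i m 0
  have hl₂ := borosMollTerm_succ_left i (m + 1) 0
  have hr₁ := borosMollTerm_succ_right i m 0
  have hr₂ := borosMollTerm_succ_right i (m + 1) 0
  have him' : (i : ℝ) ≤ m := by exact_mod_cast him
  rw [d_eq_sum_borosMollTerm (m + 2), d_eq_sum_borosMollTerm (m + 1), d_eq_sum_borosMollTerm m,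
    Finset.sum_range_succ _ (m + 2), Finset.sum_range_succ _ (m + 1),
    Finset.sum_range_succ _ (m + 1), show m + 2 - (m + 2) = 0 by omega,
    show m + 2 - (m + 1) = 0 + 1 by omega, show m + 1 - (m + 1) = 0 by omega]
  simp only [add_zero, recOp, Finset.sum_add_distrib, Finset.sum_sub_distrib, ← Finset.mul_sum,
    Nat.cast_zero, zero_add, mul_zero, mul_one, one_mul] at hs hl₁ hl₂ hr₁ hr₂ ⊢
  push_cast at hs hl₁ hl₂ hr₁ hr₂ ⊢
  rw [hr₁] at hl₁
  rw [hr₂] at hl₂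
  rw [hr₂]
  have h₀ : borosMollTerm i m 0 =
      ((m : ℝ) + 1 - i) * borosMollTerm i (m + 1) 0 / (2 * m + 1) := by
    rw [eq_div_iff (by positivity), hl₁]
    field_simp
  have h₂ : borosMollTerm i (m + 2) 0 =
      (2 * m + 3) * borosMollTerm i (m + 1) 0 / ((m : ℝ) + 2 - i) := by
    rw [eq_div_iff (by linarith), mul_comm, show (m : ℝ) + 2 - i = m + 1 + 1 - i by ring, hl₂]
    field_simp
    ring
  rw [h₀] at hs
  rw [h₂]
  have hne : (m : ℝ) + 2 - i ≠ 0 := by linarith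
  have key : certPoly m i (m + 1) * (2 * m + 1) *
      (((m : ℝ) + 1 - i) * borosMollTerm i (m + 1) 0 / (2 * m + 1)) +
      4 * ((m : ℝ) + 2 - i) * (m + 1) * (m + 2) *
        ((2 * (m + 1) + 1) / (2 * (m + 1 + 1)) * borosMollTerm i (m + 1) 0 +
          (2 * m + 3) * borosMollTerm i (m + 1) 0 / ((m : ℝ) + 2 - i)) -
      2 * (m + 1) * (8 * m ^ 2 + 24 * m + 19 - 4 * i ^ 2) * borosMollTerm i (m + 1) 0 = 0 := by
    unfold certPoly
    field_simp
    ring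
  linear_combination hs + key

theorem bracket_neg {a i x y : ℝ} (hi : 1 ≤ i) (ha : i + 1 ≤ a) (hx : 0 ≤ x) (hy : 0 ≤ y)
    (hx2 : x ^ 2 = 4 * a + 4 * i ^ 2 - 3) (hy2 : y ^ 2 = 4 * a + 4 * i ^ 2 + 1) :
    4 * i ^ 3 - i + (4 * a ^ 2 - 2 * i ^ 2) * (x - y) + a * (x + y) - i * (x * y) < 0 := by
  have hx1 : 2 * i + 1 ≤ x := by
    apply le_of_sq_le_sq _ hx
    nlinarith
  have hy1 : 2 * i + 1 ≤ y := by
    apply le_of_sq_le_sq _ hy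
    nlinarith
  have hupper : x * y ≤ 4 * a + 4 * i ^ 2 - 1 := by nlinarith [sq_nonneg (x - y)]
  have hlower : (2 * i + 1) * (4 * a + 4 * i ^ 2 - 1) - 1 ≤ (2 * i + 1) * (x * y) := by
    apply le_of_sq_le_sq _ (by positivity)
    have : ((2 * i + 1) * (x * y)) ^ 2 = (2 * i + 1) ^ 2 *
        ((4 * a + 4 * i ^ 2 - 3) * (4 * a + 4 * i ^ 2 + 1)) := by
      rw [← hx2, ← hy2]; ring
    rw [this]
    have h₁ : (2 * i + 1) * (2 * i + 1) ^ 2 ≤ (2 * i + 1) * (4 * a + 4 * i ^ 2 - 1) :=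
      mul_le_mul_of_nonneg_left (by nlinarith) (by linarith)
    nlinarith
  have hs : 0 < x + y := by linarith
  have hneg : 4 * i ^ 2 - 1 - x * y ≤ 0 := by
    nlinarith
  have h₁ : i * ((4 * i ^ 2 - 1 - x * y) * (x + y)) ≤ i * (-8 * a * (2 * i + 1) + 2) := by
    apply mul_le_mul_of_nonneg_left _ (by linarith)
    nlinarith
  have h₂ : a * (x + y) ^ 2 ≤ a * (16 * a + 16 * i ^ 2 - 4) :=
    mul_le_mul_of_nonneg_left (by nlinarith) (by linarith)
  have h₃ : (x - y) * (x + y) = -4 := by linear_combination hx2 - hy2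
  refine neg_of_mul_neg_left (b := x + y) ?_ hs.le
  have h₄ : (4 * i ^ 3 - i + (4 * a ^ 2 - 2 * i ^ 2) * (x - y) + a * (x + y) - i * (x * y)) *
      (x + y) = i * ((4 * i ^ 2 - 1 - x * y) * (x + y)) + a * (x + y) ^ 2 -
        4 * (4 * a ^ 2 - 2 * i ^ 2) := by
    linear_combination (4 * a ^ 2 - 2 * i ^ 2) * h₃
  rw [h₄]
  nlinarith

theorem T_pos {m i : ℕ} (him : i ≤ m) : 0 < T m i := by
  have h : (i : ℝ) ≤ m := by exact_mod_cast him
  have h0 : (0 : ℝ) ≤ i := by positivity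
  have hs : 0 ≤ i * Real.sqrt (4 * m + 4 * i ^ 2 + 1) := by positivity
  unfold T
  apply div_pos
  · nlinarith
  · have : (0 : ℝ) < m - i + 1 := by linarith
    positivity

theorem recOp_T_pos {m i : ℕ} (hi : 1 ≤ i) (him : i ≤ m) :
    0 < recOp m i (T (m + 1) i * T m i) (T m i) 1 := by
  have hi' : (1 : ℝ) ≤ i := by exact_mod_cast hi
  have h : (i : ℝ) ≤ m := by exact_mod_cast him
  unfold T
  push_cast
  set x := Real.sqrt (4 * (m : ℝ) + 4 * i ^ 2 + 1) with hx
  set y := Real.sqrt (4 * ((m : ℝ) + 1) + 4 * i ^ 2 + 1) with hy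
  have hx2 : x ^ 2 = 4 * ((m : ℝ) + 1) + 4 * i ^ 2 - 3 := by
    rw [hx, Real.sq_sqrt (by positivity)]; ring
  have hy2 : y ^ 2 = 4 * ((m : ℝ) + 1) + 4 * i ^ 2 + 1 := by
    rw [hy, Real.sq_sqrt (by positivity)]
  have hb := bracket_neg hi' (show (i : ℝ) + 1 ≤ m + 1 by linarith) (Real.sqrt_nonneg _)
    (Real.sqrt_nonneg _) hx2 hy2
  have hne₁ : (m : ℝ) - i + 1 ≠ 0 := by linarith
  have hne₂ : (m : ℝ) + 1 - i + 1 ≠ 0 := by linarith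
  have hpos : (0 : ℝ) < m - i + 1 := by linarith
  have key : recOp m i ((4 * ((m : ℝ) + 1) ^ 2 + 7 * (m + 1) + 3 + i * y - 2 * i ^ 2) /
        (2 * ((m : ℝ) + 1 - i + 1) * ((m : ℝ) + 1 + 1)) *
      ((4 * (m : ℝ) ^ 2 + 7 * m + 3 + i * x - 2 * i ^ 2) /
        (2 * ((m : ℝ) - i + 1) * ((m : ℝ) + 1))))
      ((4 * (m : ℝ) ^ 2 + 7 * m + 3 + i * x - 2 * i ^ 2) /
        (2 * ((m : ℝ) - i + 1) * ((m : ℝ) + 1))) 1 =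
      -(i * (4 * (i : ℝ) ^ 3 - i + (4 * ((m : ℝ) + 1) ^ 2 - 2 * i ^ 2) * (x - y) +
        (m + 1) * (x + y) - i * (x * y))) / (m - i + 1) := by
    unfold recOp
    field_simp
    ring
  rw [key]
  apply div_pos _ hpos
  nlinarith

theorem d_add_two_lt {m i : ℕ} (hi : 1 ≤ i) (him : i ≤ m) (h : d (m + 1) i ≤ T m i * d m i) :
    d (m + 2) i < T (m + 1) i * d (m + 1) i := by
  have hrec := recOp_d hi him
  have hT := recOp_T_pos hi him
  have hTpos := T_pos him
  have hd := d_pos (show i ≤ m + 1 by omega)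
  have him' : (i : ℝ) ≤ m := by exact_mod_cast him
  have hc : 0 < 4 * ((m : ℝ) + 2 - i) * (m + 1) * (m + 2) := by
    have : (0 : ℝ) < m + 2 - i := by linarith
    positivity
  have h₁ := mul_le_mul_of_nonneg_left h
    (show 0 ≤ ((m : ℝ) + i + 1) * (4 * m + 3) * (4 * m + 5) by positivity)
  have h₂ := mul_pos hT hd
  unfold recOp at hrec h₂
  have h₃ : 0 < (4 * ((m : ℝ) + 2 - i) * (m + 1) * (m + 2) * T m i) *
      (T (m + 1) i * d (m + 1) i - d (m + 2) i) := by
    linear_combination h₁ + h₂ + T m i * hrec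
  exact sub_pos.mp (pos_of_mul_pos_right h₃ (by positivity))

theorem d_self_succ (i : ℕ) : d (i + 1) i = T i i * d i i := by
  have hT : T i i = (2 * i + 1) * (2 * i + 3) / (2 * (i + 1)) := by
    have : Real.sqrt (4 * (i : ℝ) + 4 * i ^ 2 + 1) = 2 * i + 1 := by
      rw [show 4 * (i : ℝ) + 4 * i ^ 2 + 1 = (2 * i + 1) ^ 2 by ring]
      exact Real.sqrt_sq (by positivity)
    unfold T
    rw [this, sub_self]
    field_simp
    ring
  have h : ∀ e, ∑ k ∈ Finset.range i, borosMollTerm i k (i + e - k) = 0 := fun e =>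
    Finset.sum_eq_zero fun k hk => borosMollTerm_eq_zero (Finset.mem_range.mp hk) _
  have h₀ := h 0
  rw [add_zero] at h₀
  have hl := borosMollTerm_succ_left i i 0
  have hr := borosMollTerm_succ_right i i 0
  rw [hT, d_eq_sum_borosMollTerm, d_eq_sum_borosMollTerm, Finset.sum_range_succ,
    Finset.sum_range_succ, Finset.sum_range_succ, h, h₀,
    show i + 1 - i = 0 + 1 by omega, show i + 1 - (i + 1) = 0 by omega, Nat.sub_self]
  rw [hr] at hl ⊢
  push_cast at hl ⊢
  have hl' : borosMollTerm i (i + 1) 0 = (2 * i + 1) * borosMollTerm i i 0 := by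
    have e : borosMollTerm i (i + 1) 0 =
      ((i : ℝ) + 1 - i) * (2 * 0 + 1) * borosMollTerm i (i + 1) 0 := by ring
    rw [e, hl]
    field_simp
    ring
  rw [hl']
  field_simp
  ring

theorem d_succ_le {m i : ℕ} (hi : 1 ≤ i) (him : i ≤ m) : d (m + 1) i ≤ T m i * d m i := by
  induction m, him using Nat.le_induction with
  | base => exact (d_self_succ i).le
  | succ m him ih => exact (d_add_two_lt hi him ih).le

theorem boros_moll_ratio_lt_T (m i : ℕ) (hm : 2 ≤ m) (hi : 1 ≤ i) (hi' : i ≤ m - 1) :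
    d (m + 1) i / d m i < T m i := by
  obtain ⟨n, rfl⟩ : ∃ n, m = n + 1 := ⟨m - 1, by omega⟩
  have hin : i ≤ n := by omega
  rw [div_lt_iff₀ (d_pos (by omega))]
  exact d_add_two_lt hi hin (d_succ_le hi hin)
end
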